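/- (First-order commutator estimate) Let n ≥ 1, s > 0, p ∈ [1/2,∞], p₁,p₂ ∈ [1,∞], and a,a₁,a₂ ≥ 0 satisfy 1/p = 1/p₁ + 1/p₂ and a/p = a₁/p₁ + a₂/p₂. Then there exists C > 0, independent of k, f, g, such that for every k ∈ ℕ and all f, g ∈ 𝒮(ℝⁿ): ‖ J^s( (S_{k−3} f)(Δ_k g) ) − (S_{k−3} f)·J^s(Δ_k g) ‖_{L^p_{⟨x⟩^a}} ≤ C 2^{k(s−1)} ‖∇(S_{k−3} f)‖_{L^{p₁}_{⟨x⟩^{a₁}}} ‖Δ_k g‖_{L^{p₂}_{⟨x⟩^{a₂}}}. -/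

import Mathlib

open MeasureTheory Real Complex
open scoped ENNReal NNReal RealInnerProductSpace

noncomputable section

abbrev Eu (n : ℕ) := EuclideanSpace ℝ (Fin n)

/-- The polynomial weight `⟨x⟩^a = (1+|x|²)^{a/2}` as an `ℝ≥0∞`-valued function. -/
def jweight {n : ℕ} (a : ℝ) (x : Eu n) : ℝ≥0∞ :=
  ENNReal.ofReal ((1 + ‖x‖ ^ 2) ^ (a / 2))

/-- Weighted Lebesgue (quasi-)norm `‖f‖_{L^p_{⟨x⟩^a}}`; for `p = ∞` the essential sup norm. -/
def wNorm {n : ℕ} {F : Type*} [NormedAddCommGroup F] (p : ℝ≥0∞) (a : ℝ)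
    (f : Eu n → F) : ℝ≥0∞ :=
  if p = ∞ then essSup (fun x => (‖f x‖₊ : ℝ≥0∞)) volume
  else (∫⁻ x, (‖f x‖₊ : ℝ≥0∞) ^ p.toReal * jweight a x) ^ (1 / p.toReal)

/-- The Fourier transform `f̂(ξ) = ∫ f(x) e^{-i x·ξ} dx`. -/
def FT {n : ℕ} (f : Eu n → ℂ) (ξ : Eu n) : ℂ :=
  ∫ x, f x * Complex.exp (-(Complex.I * ((⟪x, ξ⟫ : ℝ) : ℂ)))

/-- The inhomogeneous fractional derivative (Bessel potential) `J^s`. -/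
def Js {n : ℕ} (s : ℝ) (f : Eu n → ℂ) (x : Eu n) : ℂ :=
  ((((2 * Real.pi) ^ n)⁻¹ : ℝ) : ℂ) *
    ∫ ξ, (((1 + ‖ξ‖ ^ 2) ^ (s / 2) : ℝ) : ℂ) * FT f ξ *
      Complex.exp (Complex.I * ((⟪x, ξ⟫ : ℝ) : ℂ))

/-- The Euclidean norm `|∇f|(x)` of the gradient of a complex-valued function. -/
def gradNorm {n : ℕ} (f : Eu n → ℂ) (x : Eu n) : ℝ :=
  Real.sqrt (∑ j : Fin n, ‖fderiv ℝ f x (EuclideanSpace.single j 1)‖ ^ 2)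

/-- The "dot product" of gradients `∇f·∇g = Σ_j (∂_j f)(∂_j g)`. -/
def gradDot {n : ℕ} (f g : Eu n → ℂ) (x : Eu n) : ℂ :=
  ∑ j : Fin n, fderiv ℝ f x (EuclideanSpace.single j 1) *
    fderiv ℝ g x (EuclideanSpace.single j 1)

/-- A Littlewood–Paley bump: `Φ ∈ C_c^∞(ℝⁿ)` with `0 ≤ Φ ≤ 1`, `Φ = 1` on `|ξ| ≤ 1` and
`Φ = 0` on `|ξ| ≥ 2`. -/
def IsLPBump {n : ℕ} (Φ : Eu n → ℝ) : Prop :=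
  ContDiff ℝ (⊤ : ℕ∞) Φ ∧ (∀ ξ, 0 ≤ Φ ξ ∧ Φ ξ ≤ 1) ∧
    (∀ ξ, ‖ξ‖ ≤ 1 → Φ ξ = 1) ∧ (∀ ξ, 2 ≤ ‖ξ‖ → Φ ξ = 0)

/-- The low-frequency projection `S_k f`, with Fourier multiplier `Φ(2^{-k}ξ)`. -/
def SProj {n : ℕ} (Φ : Eu n → ℝ) (k : ℤ) (f : Eu n → ℂ) (x : Eu n) : ℂ :=
  ((((2 * Real.pi) ^ n)⁻¹ : ℝ) : ℂ) *
    ∫ ξ, ((Φ ((2 : ℝ) ^ (-k) • ξ) : ℝ) : ℂ) * FT f ξ *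
      Complex.exp (Complex.I * ((⟪x, ξ⟫ : ℝ) : ℂ))

/-- The Littlewood–Paley piece `Δ_k f = S_k f - S_{k-1} f`, with Fourier multiplier
`Ψ(2^{-k}ξ) = Φ(2^{-k}ξ) - Φ(2^{-(k-1)}ξ)`. -/
def DProj {n : ℕ} (Φ : Eu n → ℝ) (k : ℤ) (f : Eu n → ℂ) (x : Eu n) : ℂ :=
  SProj Φ k f x - SProj Φ (k - 1) f x

open scoped FourierTransform LineDeriv

lemma slice_deriv_bound {n : ℕ} (M : ℝ × Eu n → ℂ) (hM : ContDiff ℝ (⊤ : ℕ∞) M) (B : ℝ) (j : ℕ) :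
    ∃ D : ℝ, 0 ≤ D ∧ ∀ ε ∈ Set.Icc (0:ℝ) 1, ∀ η ∈ Metric.closedBall (0 : Eu n) B,
      ‖iteratedFDeriv ℝ j (fun η => M (ε, η)) η‖ ≤ D := by
  have hc : Continuous (iteratedFDeriv ℝ j M) :=
    hM.continuous_iteratedFDeriv (by exact_mod_cast le_top)
  have hK : IsCompact ((Set.Icc (0:ℝ) 1) ×ˢ (Metric.closedBall (0 : Eu n) B)) :=
    isCompact_Icc.prod (isCompact_closedBall _ _)
  obtain ⟨D, hD⟩ := hK.exists_bound_of_continuousOn hc.continuousOn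
  refine ⟨max D 0, le_max_right _ _, fun ε hε η hη => ?_⟩
  have e1 : (fun η => M (ε, η)) =
      (fun y => M (y + (ε, 0))) ∘ (ContinuousLinearMap.inr ℝ ℝ (Eu n)) := by
    ext η; simp
  rw [e1, ContinuousLinearMap.iteratedFDeriv_comp_right (n := (⊤ : ℕ∞)) _ (by fun_prop) _
    (by exact_mod_cast le_top), iteratedFDeriv_comp_add_right]
  refine (ContinuousMultilinearMap.norm_compContinuousLinearMap_le _ _).trans ?_
  have h1 : ‖ContinuousLinearMap.inr ℝ ℝ (Eu n)‖ ≤ 1 := ContinuousLinearMap.norm_inr_le_one ..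
  have h2 : ∏ i : Fin j, ‖ContinuousLinearMap.inr ℝ ℝ (Eu n)‖ ≤ 1 :=
    Finset.prod_le_one (fun _ _ => norm_nonneg _) (fun _ _ => h1)
  have h3 := hD (ε, η) ⟨hε, hη⟩
  simp only [ContinuousLinearMap.inr_apply, Prod.mk_add_mk, zero_add, add_zero]
  calc _ ≤ D * 1 := by
        apply mul_le_mul h3 h2 (by positivity) ((norm_nonneg _).trans h3)
    _ ≤ _ := by simp

lemma slice_int_bound {n : ℕ} (M : ℝ × Eu n → ℂ) (hM : ContDiff ℝ (⊤ : ℕ∞) M) (B : ℝ)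
    (hB : ∀ ε η, B ≤ ‖η‖ → M (ε, η) = 0) (j : ℕ) :
    ∃ D : ℝ, 0 ≤ D ∧ ∀ ε ∈ Set.Icc (0:ℝ) 1,
      ∫ η, ‖iteratedFDeriv ℝ j (fun η => M (ε, η)) η‖ ≤ D := by
  obtain ⟨D, hD0, hD⟩ := slice_deriv_bound M hM B j
  refine ⟨D * volume.real (Metric.closedBall (0 : Eu n) B), by positivity, fun ε hε => ?_⟩
  have hz : ∀ η, η ∉ Metric.closedBall (0 : Eu n) B →
      ‖iteratedFDeriv ℝ j (fun η => M (ε, η)) η‖ = 0 := by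
    intro η hη
    rw [norm_eq_zero]
    by_contra h
    have h1 := support_iteratedFDeriv_subset (𝕜 := ℝ) (f := fun η => M (ε, η)) j h
    have h2 : tsupport (fun η => M (ε, η)) ⊆ Metric.closedBall (0 : Eu n) B := by
      apply closure_minimal _ Metric.isClosed_closedBall
      intro x hx
      by_contra hx'
      apply hx
      apply hB
      simp at hx'
      exact hx'.le
    exact hη (h2 h1)
  rw [← setIntegral_eq_integral_of_forall_compl_eq_zero hz]
  refine (le_abs_self _).trans ?_
  rw [← Real.norm_eq_abs]
  refine norm_setIntegral_le_of_norm_le_const (measure_closedBall_lt_top) ?_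
  intro η hη
  simpa using hD ε hε η hη

lemma slice_contDiff {n : ℕ} (M : ℝ × Eu n → ℂ) (hM : ContDiff ℝ (⊤ : ℕ∞) M) (ε : ℝ) :
    ContDiff ℝ (⊤ : ℕ∞) (fun η => M (ε, η)) := by fun_prop

lemma slice_compact {n : ℕ} (M : ℝ × Eu n → ℂ) (B : ℝ)
    (hB : ∀ ε η, B ≤ ‖η‖ → M (ε, η) = 0) (ε : ℝ) :
    HasCompactSupport (fun η => M (ε, η)) := by
  apply HasCompactSupport.intro (isCompact_closedBall (0 : Eu n) B)
  intro x hx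
  apply hB
  simp at hx
  exact hx.le

lemma decay {n : ℕ} (M : ℝ × Eu n → ℂ) (hM : ContDiff ℝ (⊤ : ℕ∞) M) (B : ℝ)
    (hB : ∀ ε η, B ≤ ‖η‖ → M (ε, η) = 0) (N : ℕ) :
    ∃ c : ℝ, 0 < c ∧ ∀ ε ∈ Set.Icc (0:ℝ) 1, ∀ z,
      ‖𝓕⁻ (fun η => M (ε, η)) z‖ ≤ c * (1 + ‖z‖) ^ (-(N : ℝ)) := by
  choose D hD0 hD using fun j => slice_int_bound M hM B hB j
  set E : ℕ → ℝ := fun m => 2 ^ m * ∑ j ∈ Finset.range (m + 1), D j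
  have key : ∀ m : ℕ, ∀ ε ∈ Set.Icc (0:ℝ) 1, ∀ w : Eu n,
      ‖w‖ ^ m * ‖𝓕 (fun η => M (ε, η)) w‖ ≤ E m := by
    intro m ε hε w
    have hcd := slice_contDiff M hM ε
    have hcs := slice_compact M B hB ε
    have := pow_mul_norm_iteratedFDeriv_fourier_le (K := 0) (N := ⊤) (f := fun η => M (ε, η))
      hcd (by
        intro k j _ _
        apply Continuous.integrable_of_hasCompactSupport
        · have := hcd.continuous_iteratedFDeriv (m := j) (by exact_mod_cast le_top)
          fun_prop
        · exact (hcs.iteratedFDeriv j).norm.mul_left) (k := 0) (n := m) (by simp) (by simp) w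
    simp only [norm_iteratedFDeriv_zero] at this
    refine this.trans ?_
    simp only [Finset.sum_product, zero_add, Finset.range_one, Finset.sum_singleton, pow_zero, one_mul, CharP.cast_eq_zero, mul_zero]
    simp only [E]
    gcongr with j hj
    exact hD j ε hε
  refine ⟨2 ^ N * (E 0 + E N) + 1, ?_, fun ε hε z => ?_⟩
  · have hE : ∀ m, 0 ≤ E m := fun m => mul_nonneg (by positivity) (Finset.sum_nonneg fun j _ => hD0 j)
    have := hE 0
    have := hE N
    positivity
  have h0 := key 0 ε hε (-z)
  have hN := key N ε hε (-z)
  rw [Real.fourierInv_eq_fourier_neg]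
  set X := ‖𝓕 (fun η => M (ε, η)) (-z)‖
  rw [norm_neg] at h0 hN
  have hX : 0 ≤ X := norm_nonneg _
  rw [Real.rpow_neg (by positivity), Real.rpow_natCast, ← div_eq_mul_inv, le_div_iff₀ (by positivity)]
  have h1 : (1 + ‖z‖) ^ N ≤ 2 ^ N * (1 + ‖z‖ ^ N) := by
    have : (1 + ‖z‖) ≤ 2 * max 1 ‖z‖ := by
      have := le_max_left 1 ‖z‖; have := le_max_right 1 ‖z‖; linarith
    calc _ ≤ (2 * max 1 ‖z‖) ^ N := by gcongr
      _ = 2 ^ N * (max 1 ‖z‖) ^ N := by rw [mul_pow]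
      _ ≤ _ := by
        gcongr
        rcases max_choice 1 ‖z‖ with h | h <;> rw [h]
        · simp
        · simp
  calc X * (1 + ‖z‖) ^ N ≤ X * (2 ^ N * (1 + ‖z‖ ^ N)) := by gcongr
    _ = 2 ^ N * (‖z‖ ^ 0 * X + ‖z‖ ^ N * X) := by ring
    _ ≤ 2 ^ N * (E 0 + E N) := by gcongr
    _ ≤ _ := by linarith

lemma measurable_jweight {n : ℕ} (c : ℝ) : Measurable (jweight c : Eu n → ℝ≥0∞) := by
  unfold jweight; fun_prop

lemma jweight_rpow {n : ℕ} (c q : ℝ) (hq : 0 ≤ q) (x : Eu n) :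
    (jweight c x) ^ q = jweight (c * q) x := by
  unfold jweight
  rw [ENNReal.ofReal_rpow_of_nonneg (by positivity) hq, ← Real.rpow_mul (by positivity)]
  congr 2; ring

lemma jweight_add {n : ℕ} (c d : ℝ) (x : Eu n) :
    jweight (c + d) x = jweight c x * jweight d x := by
  unfold jweight
  rw [← ENNReal.ofReal_mul (by positivity), ← Real.rpow_add (by positivity)]
  congr 2; ring

lemma jweight_zero {n : ℕ} (x : Eu n) : jweight 0 x = 1 := by simp [jweight]

lemma wNorm_eq {n : ℕ} {F : Type*} [NormedAddCommGroup F] (p : ℝ≥0∞) (hp : p ≠ 0) (a : ℝ)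
    (f : Eu n → F) :
    wNorm p a f = eLpNorm (fun x => jweight (a / p.toReal) x * ‖f x‖ₑ) p volume := by
  unfold wNorm
  split_ifs with h
  · subst h
    simp [eLpNorm_exponent_top, eLpNormEssSup, jweight_zero, enorm_eq_nnnorm]
  · have hq : 0 < p.toReal := ENNReal.toReal_pos hp h
    rw [eLpNorm_eq_lintegral_rpow_enorm_toReal hp h]
    congr 2
    ext x
    simp only [enorm_eq_self]
    rw [ENNReal.mul_rpow_of_nonneg _ _ hq.le, jweight_rpow _ _ hq.le, div_mul_cancel₀ _ hq.ne',
      mul_comm, enorm_eq_nnnorm]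

lemma holder_enn {n : ℕ} (p p₁ p₂ : ℝ≥0∞) (h1 : 1 ≤ p₁) (h2 : 1 ≤ p₂)
    (h : 1 / p = 1 / p₁ + 1 / p₂) (u v : Eu n → ℝ≥0∞) (hu : Measurable u) (hv : Measurable v) :
    eLpNorm (fun x => u x * v x) p volume ≤ eLpNorm u p₁ volume * eLpNorm v p₂ volume := by
  rcases eq_or_ne p₁ ∞ with rfl | h1'
  · have : p = p₂ := by simpa using h
    subst this
    rw [eLpNorm_exponent_top]
    apply eLpNorm_le_mul_eLpNorm_of_ae_le_mul''
    · exact hv.aestronglyMeasurable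
    filter_upwards [enorm_ae_le_eLpNormEssSup u volume] with x hx
    simp only [enorm_eq_self] at hx ⊢
    gcongr
  rcases eq_or_ne p₂ ∞ with rfl | h2'
  · have : p = p₁ := by simpa using h
    subst this
    rw [eLpNorm_exponent_top, mul_comm]
    apply eLpNorm_le_mul_eLpNorm_of_ae_le_mul''
    · exact hu.aestronglyMeasurable
    filter_upwards [enorm_ae_le_eLpNormEssSup v volume] with x hx
    simp only [enorm_eq_self] at hx ⊢
    rw [mul_comm]
    gcongr
  have hp₁ : 0 < p₁.toReal := ENNReal.toReal_pos (by positivity) h1'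
  have hp₂ : 0 < p₂.toReal := ENNReal.toReal_pos (by positivity) h2'
  have hpqr' : 1 / p.toReal = 1 / p₁.toReal + 1 / p₂.toReal := by
    have := congrArg ENNReal.toReal h
    rw [ENNReal.toReal_add (by simp; rintro rfl; simp at h1) (by simp; rintro rfl; simp at h2)] at this
    simpa using this
  have hr : 0 < p.toReal := one_div_pos.mp <| by rw [hpqr']; positivity
  obtain ⟨hr₁, hr₂⟩ := ENNReal.toReal_pos_iff.mp hr
  have hrp : p.toReal < p₁.toReal := lt_of_one_div_lt_one_div hp₁ <|
    hpqr' ▸ lt_add_of_pos_right _ (by positivity)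
  rw [eLpNorm_eq_lintegral_rpow_enorm_toReal hr₁.ne' hr₂.ne,
    eLpNorm_eq_lintegral_rpow_enorm_toReal (by positivity) h1',
    eLpNorm_eq_lintegral_rpow_enorm_toReal (by positivity) h2']
  simpa using ENNReal.lintegral_Lp_mul_le_Lq_mul_Lr hr hrp hpqr' volume hu.aemeasurable hv.aemeasurable

lemma jensen_enn {n : ℕ} (q : ℝ) (hq : 1 ≤ q) (w u : Eu n → ℝ≥0∞) (hw : Measurable w)
    (hu : Measurable u) :
    (∫⁻ y, w y * u y) ^ q ≤ (∫⁻ y, w y) ^ (q - 1) * ∫⁻ y, w y * u y ^ q := by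
  rcases hq.eq_or_lt with rfl | hq
  · simp
  have hc := Real.HolderConjugate.conjExponent hq
  set r := Real.conjExponent q
  have h := ENNReal.lintegral_mul_le_Lp_mul_Lq volume hc.symm
    (f := fun y => w y ^ (1 / r)) (g := fun y => w y ^ (1 / q) * u y)
    (by fun_prop) (by fun_prop)
  have e0 : ∀ y, w y ^ (1 / r) * (w y ^ (1 / q) * u y) = w y * u y := by
    intro y
    rw [← mul_assoc, ← ENNReal.rpow_add_of_nonneg _ _ (by have := hc.symm.pos; positivity) (by positivity)]
    have := hc.symm.inv_add_inv_eq_one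
    simp only [one_div]
    rw [this, ENNReal.rpow_one]
  have e1 : ∀ y, (w y ^ (1 / r)) ^ r = w y := by
    intro y
    rw [← ENNReal.rpow_mul, one_div_mul_cancel hc.symm.pos.ne', ENNReal.rpow_one]
  have e2 : ∀ y, (w y ^ (1 / q) * u y) ^ q = w y * u y ^ q := by
    intro y
    rw [ENNReal.mul_rpow_of_nonneg _ _ (by positivity), ← ENNReal.rpow_mul,
      one_div_mul_cancel (by positivity), ENNReal.rpow_one]
  simp only [Pi.mul_apply, e0, e1, e2] at h
  calc _ ≤ ((∫⁻ y, w y) ^ (1 / r) * (∫⁻ y, w y * u y ^ q) ^ (1 / q)) ^ q := by gcongr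
    _ = _ := by
      rw [ENNReal.mul_rpow_of_nonneg _ _ (by positivity), ← ENNReal.rpow_mul, ← ENNReal.rpow_mul,
        one_div_mul_cancel (by positivity), ENNReal.rpow_one]
      congr 2
      have := hc.symm.inv_add_inv_eq_one
      have h3 : r⁻¹ = 1 - q⁻¹ := by linarith
      rw [one_div, h3]
      field_simp

lemma young_enn {n : ℕ} (q : ℝ≥0∞) (hq : 1 ≤ q) (w u : Eu n → ℝ≥0∞) (hw : Measurable w)
    (hu : Measurable u) :
    eLpNorm (fun x => ∫⁻ y, w (x - y) * u y) q volume ≤ (∫⁻ z, w z) * eLpNorm u q volume := by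
  have hI : ∀ x, ∫⁻ y, w (x - y) = ∫⁻ z, w z := fun x => lintegral_sub_left_eq_self w x
  rcases eq_or_ne q ∞ with rfl | hq'
  · rw [eLpNorm_exponent_top, eLpNorm_exponent_top]
    refine essSup_le_of_ae_le _ (Filter.Eventually.of_forall fun x => ?_)
    simp only [enorm_eq_self]
    calc ∫⁻ y, w (x - y) * u y ≤ ∫⁻ y, w (x - y) * eLpNormEssSup u volume := by
          apply lintegral_mono_ae
          filter_upwards [enorm_ae_le_eLpNormEssSup u volume] with y hy
          simp only [enorm_eq_self] at hy
          gcongr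
      _ = _ := by rw [lintegral_mul_const _ (by fun_prop), hI]
  have hq0 : 1 ≤ q.toReal := by
    rw [← ENNReal.toReal_one]; exact ENNReal.toReal_mono hq' hq
  set r := q.toReal
  have hr : 0 < r := by linarith
  rw [eLpNorm_eq_lintegral_rpow_enorm_toReal (by positivity) hq',
    eLpNorm_eq_lintegral_rpow_enorm_toReal (by positivity) hq']
  simp only [enorm_eq_self]
  set W := ∫⁻ z, w z
  have key : ∫⁻ x, (∫⁻ y, w (x - y) * u y) ^ r ≤ W ^ r * ∫⁻ y, u y ^ r := by
    calc _ ≤ ∫⁻ x, W ^ (r - 1) * ∫⁻ y, w (x - y) * u y ^ r := by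
          apply lintegral_mono; intro x
          have := jensen_enn r hq0 (fun y => w (x - y)) u (by fun_prop) hu
          rwa [hI] at this
      _ = W ^ (r - 1) * ∫⁻ x, ∫⁻ y, w (x - y) * u y ^ r := by
          rw [lintegral_const_mul]
          apply Measurable.lintegral_prod_right' (f := fun z : Eu n × Eu n => w (z.1 - z.2) * u z.2 ^ r)
          fun_prop
      _ = W ^ (r - 1) * ∫⁻ y, ∫⁻ x, w (x - y) * u y ^ r := by
          rw [lintegral_lintegral_swap]
          apply Measurable.aemeasurable
          unfold Function.uncurry
          fun_prop
      _ = W ^ (r - 1) * (W * ∫⁻ y, u y ^ r) := by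
          congr 1
          rw [← lintegral_const_mul _ (by fun_prop)]
          congr 1; ext y
          rw [lintegral_mul_const _ (by fun_prop), lintegral_sub_right_eq_self w y]
      _ = _ := by
          rw [← mul_assoc]
          congr 1
          conv_lhs => rw [← ENNReal.rpow_one W, ← ENNReal.rpow_mul, one_mul]
          rw [← ENNReal.rpow_add_of_nonneg _ _ (by linarith) (by linarith)]
          congr 1; ring
  calc _ ≤ (W ^ r * ∫⁻ y, u y ^ r) ^ (1 / r) := by gcongr
    _ = _ := by
      rw [ENNReal.mul_rpow_of_nonneg _ _ (by positivity), ← ENNReal.rpow_mul,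
        mul_one_div_cancel hr.ne', ENNReal.rpow_one]

/-- rescaled polynomial kernel -/
def om {n : ℕ} (R r : ℝ) (z : Eu n) : ℝ≥0∞ := ENNReal.ofReal (R ^ n * (1 + R * ‖z‖) ^ (-r))

lemma measurable_om {n : ℕ} (R r : ℝ) : Measurable (om R r : Eu n → ℝ≥0∞) := by
  unfold om; fun_prop

lemma lintegral_om {n : ℕ} (R r : ℝ) (hR : 0 < R) :
    ∫⁻ z : Eu n, om R r z = ∫⁻ z : Eu n, om 1 r z := by
  have h : ∫⁻ z : Eu n, om 1 r (R • z) =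
      ENNReal.ofReal |(R ^ Module.finrank ℝ (Eu n))⁻¹| * ∫⁻ z : Eu n, om 1 r z := by
    rw [← lintegral_map (measurable_om 1 r) (measurable_const_smul R),
      Measure.map_addHaar_smul _ hR.ne', lintegral_smul_measure, smul_eq_mul]
  have e : ∀ z : Eu n, om R r z = ENNReal.ofReal (R ^ n) * om 1 r (R • z) := by
    intro z
    unfold om
    rw [ENNReal.ofReal_mul (by positivity)]
    simp [norm_smul, abs_of_pos hR]
  simp only [e]
  rw [lintegral_const_mul _ (by have := measurable_om (n := n) 1 r; fun_prop), h]
  rw [← mul_assoc, ← ENNReal.ofReal_mul (by positivity)]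
  simp only [finrank_euclideanSpace, Fintype.card_fin]
  rw [abs_of_pos (by positivity), mul_inv_cancel₀ (by positivity)]
  simp

lemma lintegral_om_lt_top {n : ℕ} (r : ℝ) (hr : n < r) :
    ∫⁻ z : Eu n, om 1 r z < ∞ := by
  have := finite_integral_one_add_norm (E := Eu n) (μ := volume) (r := r) (by simpa using hr)
  simpa [om] using this

lemma jweight_le {n : ℕ} (c R : ℝ) (hc : 0 ≤ c) (hR : 1 ≤ R) (x y : Eu n) :
    jweight c x ≤ ENNReal.ofReal (2 ^ (c / 2) * (1 + R * ‖x - y‖) ^ c) * jweight c y := by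
  unfold jweight
  rw [← ENNReal.ofReal_mul (by positivity)]
  apply ENNReal.ofReal_le_ofReal
  have h1 : 1 + ‖x‖ ^ 2 ≤ 2 * (1 + R * ‖x - y‖) ^ 2 * (1 + ‖y‖ ^ 2) := by
    have h2 : ‖x‖ ≤ ‖x - y‖ + ‖y‖ := by simpa using norm_add_le (x - y) y
    have h3 : ‖x - y‖ ≤ R * ‖x - y‖ := le_mul_of_one_le_left (norm_nonneg _) hR
    have h4 : ‖x‖ ^ 2 ≤ (R * ‖x - y‖ + ‖y‖) ^ 2 := by gcongr; linarith
    have : 0 ≤ R * ‖x - y‖ := by positivity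
    set t := R * ‖x - y‖
    have h0 : 0 ≤ ‖y‖ := norm_nonneg _
    nlinarith [sq_nonneg (t - ‖y‖), mul_nonneg this (sq_nonneg ‖y‖), mul_nonneg (sq_nonneg t) (sq_nonneg ‖y‖), sq_nonneg ‖y‖, sq_nonneg t]
  calc (1 + ‖x‖ ^ 2) ^ (c / 2) ≤ (2 * (1 + R * ‖x - y‖) ^ 2 * (1 + ‖y‖ ^ 2)) ^ (c / 2) := by gcongr
    _ = _ := by
      rw [Real.mul_rpow (by positivity) (by positivity), Real.mul_rpow (by positivity) (by positivity),
        ← Real.rpow_natCast _ 2, ← Real.rpow_mul (by positivity)]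
      congr 3
      push_cast; ring

lemma weighted_conv {n : ℕ} (q : ℝ≥0∞) (hq : 1 ≤ q) (c R r : ℝ) (hc : 0 ≤ c) (hR : 1 ≤ R)
    (u : Eu n → ℝ≥0∞) (hu : Measurable u) :
    eLpNorm (fun x => jweight c x * ∫⁻ y, om R r (x - y) * u y) q volume ≤
      (ENNReal.ofReal (2 ^ (c / 2)) * ∫⁻ z : Eu n, om 1 (r - c) z) *
        eLpNorm (fun x => jweight c x * u x) q volume := by
  rw [← lintegral_om R (r - c) (by linarith), ← lintegral_const_mul _ (measurable_om _ _)]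
  refine le_trans ?_ (young_enn q hq (fun z => ENNReal.ofReal (2 ^ (c / 2)) * om R (r - c) z)
    (fun x => jweight c x * u x) ((measurable_om _ _).const_mul _) ((measurable_jweight c).mul hu))
  apply eLpNorm_mono_enorm
  intro x
  simp only [enorm_eq_self]
  rw [← lintegral_const_mul _ (by have := measurable_om (n := n) R r; fun_prop)]
  apply lintegral_mono
  intro y
  have h := jweight_le c R hc hR x y
  have e : ENNReal.ofReal (2 ^ (c / 2) * (1 + R * ‖x - y‖) ^ c) * om R r (x - y) =
      ENNReal.ofReal (2 ^ (c / 2)) * om R (r - c) (x - y) := by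
    unfold om
    rw [← ENNReal.ofReal_mul (by positivity), ← ENNReal.ofReal_mul (by positivity)]
    congr 1
    rw [neg_sub, sub_eq_add_neg c r, Real.rpow_add (by positivity)]
    ring
  calc jweight c x * (om R r (x - y) * u y)
      ≤ (ENNReal.ofReal (2 ^ (c / 2) * (1 + R * ‖x - y‖) ^ c) * jweight c y) *
        (om R r (x - y) * u y) := by gcongr
    _ = (ENNReal.ofReal (2 ^ (c / 2) * (1 + R * ‖x - y‖) ^ c) * om R r (x - y)) *
        (jweight c y * u y) := by ring
    _ = _ := by rw [e]

lemma FT_eq {n : ℕ} (f : Eu n → ℂ) (ξ : Eu n) : FT f ξ = 𝓕 f ((2 * π)⁻¹ • ξ) := by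
  unfold FT
  rw [Real.fourier_eq']
  congr 1; ext x
  rw [smul_eq_mul, mul_comm]
  congr 2
  rw [inner_smul_right]
  push_cast
  have : (π : ℂ) ≠ 0 := by exact_mod_cast Real.pi_ne_zero
  field_simp

lemma mult_eq {n : ℕ} (m : Eu n → ℂ) (h : Eu n → ℂ) (x : Eu n) :
    ((((2 * Real.pi) ^ n)⁻¹ : ℝ) : ℂ) *
      ∫ ξ, m ξ * FT h ξ * Complex.exp (Complex.I * ((⟪x, ξ⟫ : ℝ) : ℂ)) =
    𝓕⁻ (fun η => m ((2 * π) • η) * 𝓕 h η) x := by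
  rw [Real.fourierInv_eq']
  have := Measure.integral_comp_smul (volume : Measure (Eu n))
    (fun ξ => m ξ * FT h ξ * Complex.exp (Complex.I * ((⟪x, ξ⟫ : ℝ) : ℂ))) (2 * π)
  simp only [finrank_euclideanSpace, Fintype.card_fin] at this
  rw [abs_of_pos (by positivity), Complex.real_smul] at this
  rw [← this]
  congr 1; ext η
  rw [FT_eq, smul_smul, inv_mul_cancel₀ (by positivity), one_smul, smul_eq_mul, mul_comm]
  congr 2
  rw [inner_smul_right, real_inner_comm]
  push_cast; ring

lemma bump_schwartz {n : ℕ} (Φ : Eu n → ℝ) (hΦ : IsLPBump Φ) (c : ℝ) (hc : 0 < c) :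
    ∃ M : SchwartzMap (Eu n) ℂ, ∀ η, M η = ((Φ (c • η) : ℝ) : ℂ) := by
  have h1 : HasCompactSupport (fun η => ((Φ (c • η) : ℝ) : ℂ)) := by
    apply HasCompactSupport.intro (isCompact_closedBall (0 : Eu n) (2 / c))
    intro x hx
    rw [hΦ.2.2.2, Complex.ofReal_zero]
    simp at hx
    rw [norm_smul, Real.norm_eq_abs, abs_of_pos hc]
    rw [div_lt_iff₀ hc] at hx
    linarith
  have h2 : ContDiff ℝ (⊤ : ℕ∞) (fun η => ((Φ (c • η) : ℝ) : ℂ)) := by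
    apply Complex.ofRealCLM.contDiff.comp
    exact hΦ.1.comp (contDiff_const_smul c)
  exact ⟨h1.toSchwartzMap h2, fun η => rfl⟩

lemma SProj_schwartz {n : ℕ} (Φ : Eu n → ℝ) (hΦ : IsLPBump Φ) (k : ℤ) (f : SchwartzMap (Eu n) ℂ) :
    ∃ F : SchwartzMap (Eu n) ℂ, ⇑F = SProj Φ k ⇑f ∧
      ∀ η, 𝓕 (⇑F) η = ((Φ (((2 : ℝ) ^ (-k) * (2 * π)) • η) : ℝ) : ℂ) * 𝓕 (⇑f) η := by
  obtain ⟨M, hM⟩ := bump_schwartz Φ hΦ ((2 : ℝ) ^ (-k) * (2 * π)) (by positivity)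
  refine ⟨𝓕⁻ (SchwartzMap.pairing (ContinuousLinearMap.mul ℂ ℂ) M (𝓕 f)), ?_, ?_⟩
  · ext x
    unfold SProj
    rw [mult_eq (fun ξ => ((Φ ((2 : ℝ) ^ (-k) • ξ) : ℝ) : ℂ)), SchwartzMap.fourierInv_coe]
    refine congrFun (congrArg FourierTransformInv.fourierInv ?_) x
    ext η
    simp [hM, smul_smul, SchwartzMap.fourier_coe]
  · intro η
    rw [← SchwartzMap.fourier_coe, FourierTransform.fourier_fourierInv_eq]
    simp [hM, SchwartzMap.fourier_coe]

lemma flip_formula {n : ℕ} (h g : Eu n → ℂ) (hh : Integrable h) (hg : Integrable g) :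
    ∫ ξ, 𝓕 h ξ * g ξ = ∫ y, h y * 𝓕 g y := by
  have := VectorFourier.integral_fourierIntegral_smul_eq_flip (L := innerₗ (Eu n))
    (μ := volume) (ν := volume) Real.continuous_fourierChar continuous_inner hh hg
  rw [flip_innerₗ] at this
  exact this

lemma fourier_modulate {n : ℕ} (g : Eu n → ℂ) (x y : Eu n) :
    𝓕 (fun η => Complex.exp (2 * π * ⟪η, x⟫ * Complex.I) * g η) y = 𝓕⁻ g (x - y) := by
  rw [Real.fourier_eq', Real.fourierInv_eq']
  congr 1; ext η
  simp only [smul_eq_mul]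
  rw [← mul_assoc, ← Complex.exp_add]
  congr 2
  rw [inner_sub_right]
  push_cast; ring

lemma integrable_modulate {n : ℕ} (g : Eu n → ℂ) (hg : Integrable g) (x : Eu n) :
    Integrable (fun η => Complex.exp (2 * π * ⟪η, x⟫ * Complex.I) * g η) := by
  apply hg.bdd_mul (c := 1) (by fun_prop)
  filter_upwards with η
  rw [show (2 * π * (⟪η, x⟫ : ℝ) * Complex.I : ℂ) = ((2 * π * ⟪η, x⟫ : ℝ) : ℂ) * Complex.I by push_cast; ring,
    Complex.norm_exp_ofReal_mul_I]

lemma mult_conv {n : ℕ} (g h : Eu n → ℂ) (hg : Integrable g) (hh : Integrable h) (x : Eu n) :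
    𝓕⁻ (fun η => g η * 𝓕 h η) x = ∫ y, 𝓕⁻ g (x - y) * h y := by
  have := flip_formula h _ hh (integrable_modulate g hg x)
  rw [Real.fourierInv_eq']
  simp only [fourier_modulate] at this
  calc _ = ∫ ξ, 𝓕 h ξ * (Complex.exp (2 * π * ⟪ξ, x⟫ * Complex.I) * g ξ) := by
        congr 1; ext ξ
        rw [smul_eq_mul]
        push_cast; ring
    _ = _ := this
    _ = _ := by congr 1; ext y; ring

lemma fourierInv_scale {n : ℕ} (M : Eu n → ℂ) (R : ℝ) (hR : 0 < R) (z : Eu n) :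
    𝓕⁻ (fun η => M (R⁻¹ • η)) z = ((R ^ n : ℝ) : ℂ) * 𝓕⁻ M (R • z) := by
  rw [Real.fourierInv_eq', Real.fourierInv_eq']
  have := Measure.integral_comp_smul (volume : Measure (Eu n))
    (fun v => Complex.exp (↑(2 * π * ⟪v, R • z⟫) * Complex.I) • M v) (R⁻¹)
  simp only [finrank_euclideanSpace, Fintype.card_fin] at this
  rw [abs_of_pos (by positivity), Complex.real_smul, inv_pow, inv_inv] at this
  rw [← this]
  congr 1; ext v
  rw [inner_smul_left, inner_smul_right]
  simp [hR.ne']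

lemma mult_conv_scale {n : ℕ} (M h : Eu n → ℂ) (hM : Integrable M) (hh : Integrable h) (R : ℝ)
    (hR : 0 < R) (x : Eu n) :
    𝓕⁻ (fun η => M (R⁻¹ • η) * 𝓕 h η) x =
      ∫ y, ((R ^ n : ℝ) : ℂ) * 𝓕⁻ M (R • (x - y)) * h y := by
  rw [mult_conv (fun η => M (R⁻¹ • η)) h (hM.comp_smul (by positivity)) hh]
  simp only [fourierInv_scale M R hR]

lemma fourier_mul_zero {n : ℕ} (F G : SchwartzMap (Eu n) ℂ) (ξ : Eu n)
    (h : ∀ η, 𝓕 (⇑F) η = 0 ∨ 𝓕 (⇑G) (ξ - η) = 0) : 𝓕 (fun x => F x * G x) ξ = 0 := by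
  have e : (fun x => F x * G x) = fun x => F x * G x := rfl
  have hF : ⇑F = 𝓕 (fun η => 𝓕 (⇑F) (-η)) := by
    have h1 : 𝓕 (𝓕⁻ F : SchwartzMap (Eu n) ℂ) = F := FourierTransform.fourier_fourierInv_eq F
    have h2 : ⇑(𝓕⁻ F : SchwartzMap (Eu n) ℂ) = fun η => 𝓕 (⇑F) (-η) := by
      rw [SchwartzMap.fourierInv_coe]
      ext η
      rw [Real.fourierInv_eq_fourier_neg]
    rw [← h2, ← SchwartzMap.fourier_coe, h1]
  have hi : Integrable (fun η => 𝓕 (⇑F) (-η)) := by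
    rw [← SchwartzMap.fourier_coe]
    exact (𝓕 F).integrable.comp_neg
  have hfl := flip_formula _ _ hi (integrable_modulate G G.integrable (-ξ))
  rw [← hF] at hfl
  rw [Real.fourier_eq']
  calc _ = ∫ x, F x * (Complex.exp (2 * π * ⟪x, -ξ⟫ * Complex.I) * G x) := by
        congr 1; ext x
        rw [inner_neg_right, smul_eq_mul]
        push_cast
        ring_nf
    _ = _ := hfl
    _ = ∫ y, (0 : ℂ) := by
        congr 1; ext y
        rw [fourier_modulate, Real.fourierInv_eq_fourier_neg]
        rcases h (-y) with h | h
        · rw [h, zero_mul]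
        · rw [show -(-ξ - y) = ξ - -y by abel, h, mul_zero]
    _ = 0 := by simp

/-- localized symbol -/
def Msym {n : ℕ} (s : ℝ) (Φ : Eu n → ℝ) (z : ℝ × Eu n) : ℂ :=
  (((z.1 ^ 2 + ‖(2 * π) • z.2‖ ^ 2) ^ (s / 2) *
    (Φ ((π / 2) • z.2) - Φ ((16 * π) • z.2)) : ℝ) : ℂ)

lemma Msym_contDiff {n : ℕ} (s : ℝ) (Φ : Eu n → ℝ) (hΦ : IsLPBump Φ) :
    ContDiff ℝ (⊤ : ℕ∞) (Msym s Φ) := by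
  have hP := hΦ.1
  apply Complex.ofRealCLM.contDiff.comp
  rw [contDiff_iff_contDiffAt]
  rintro ⟨ε, η⟩
  by_cases h : η = 0
  · subst h
    have hev : (fun z : ℝ × Eu n => ((z.1 ^ 2 + ‖(2 * π) • z.2‖ ^ 2) ^ (s / 2) *
        (Φ ((π / 2) • z.2) - Φ ((16 * π) • z.2)) : ℝ)) =ᶠ[nhds (ε, 0)] fun _ => 0 := by
      have ho : IsOpen {z : ℝ × Eu n | ‖(16 * π) • z.2‖ < 1} :=
        isOpen_lt (by fun_prop) continuous_const
      filter_upwards [ho.mem_nhds (by simp)] with z hz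
      replace hz : ‖(16 * π) • z.2‖ < 1 := hz
      have h1 : ‖(π / 2) • z.2‖ ≤ 1 := by
        rw [norm_smul, Real.norm_eq_abs, abs_of_pos (by positivity)] at hz ⊢
        have : 0 ≤ ‖z.2‖ := norm_nonneg _
        nlinarith [Real.pi_pos, mul_nonneg Real.pi_pos.le this]
      rw [hΦ.2.2.1 _ h1, hΦ.2.2.1 _ hz.le]
      simp
    exact contDiffAt_const.congr_of_eventuallyEq hev
  · apply ContDiffAt.mul
    · apply ContDiffAt.rpow_const_of_ne
      · have : ContDiff ℝ (⊤ : ℕ∞) (fun z : ℝ × Eu n => z.1 ^ 2 + ‖(2 * π) • z.2‖ ^ 2) := by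
          apply ContDiff.add (by fun_prop)
          apply ContDiff.norm_sq ℝ
          fun_prop
        exact this.contDiffAt
      · have : 0 < ‖(2 * π) • η‖ := by
          rw [norm_pos_iff]
          exact smul_ne_zero (by positivity) h
        simp only
        positivity
    · apply ContDiff.contDiffAt
      fun_prop

lemma Msym_zero {n : ℕ} (s : ℝ) (Φ : Eu n → ℝ) (hΦ : IsLPBump Φ) (ε : ℝ) (η : Eu n)
    (h : 2 ≤ ‖η‖) : Msym s Φ (ε, η) = 0 := by
  unfold Msym
  have h1 : 2 ≤ ‖(π / 2) • η‖ := by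
    rw [norm_smul, Real.norm_eq_abs, abs_of_pos (by positivity)]
    nlinarith [Real.pi_gt_three]
  have h2 : 2 ≤ ‖(16 * π) • η‖ := by
    rw [norm_smul, Real.norm_eq_abs, abs_of_pos (by positivity)]
    nlinarith [Real.pi_gt_three]
  simp [hΦ.2.2.2 _ h1, hΦ.2.2.2 _ h2]

lemma Js_rep {n : ℕ} (s : ℝ) (Φ : Eu n → ℝ) (hΦ : IsLPBump Φ) (R : ℝ) (hR : 0 < R)
    (h : Eu n → ℂ) (hi : Integrable h)
    (h1 : ∀ η, 2 * π * ‖η‖ < R / 4 → 𝓕 h η = 0) (h2 : ∀ η, 4 * R < 2 * π * ‖η‖ → 𝓕 h η = 0)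
    (x : Eu n) :
    Js s h x = ((R ^ s : ℝ) : ℂ) *
      ∫ y, ((R ^ n : ℝ) : ℂ) * 𝓕⁻ (fun η => Msym s Φ (R⁻¹, η)) (R • (x - y)) * h y := by
  have hc := slice_contDiff _ (Msym_contDiff s Φ hΦ) R⁻¹
  have hs := slice_compact _ _ (Msym_zero s Φ hΦ) R⁻¹
  have hMi : Integrable (fun η => Msym s Φ (R⁻¹, η)) :=
    hc.continuous.integrable_of_hasCompactSupport hs
  rw [← mult_conv_scale _ _ hMi hi R hR]
  unfold Js
  rw [mult_eq (fun ξ => (((1 + ‖ξ‖ ^ 2) ^ (s / 2) : ℝ) : ℂ)), Real.fourierInv_eq',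
    Real.fourierInv_eq', ← integral_const_mul]
  congr 1; ext η
  simp only [smul_eq_mul]
  by_cases ha : 2 * π * ‖η‖ < R / 4
  · simp [h1 η ha]
  by_cases hb : 4 * R < 2 * π * ‖η‖
  · simp [h2 η hb]
  push Not at ha hb
  have key : (((1 + ‖(2 * π) • η‖ ^ 2) ^ (s / 2) : ℝ) : ℂ) =
      ((R ^ s : ℝ) : ℂ) * Msym s Φ (R⁻¹, R⁻¹ • η) := by
    unfold Msym
    simp only
    rw [← Complex.ofReal_mul]
    congr 1
    have e1 : Φ ((π / 2) • R⁻¹ • η) = 1 := by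
      apply hΦ.2.2.1
      rw [norm_smul, norm_smul, Real.norm_eq_abs, Real.norm_eq_abs, abs_of_pos (by positivity),
        abs_of_pos (by positivity), ← mul_assoc, mul_comm (π / 2), mul_assoc,
        inv_mul_le_iff₀ hR]
      linarith
    have e2 : Φ ((16 * π) • R⁻¹ • η) = 0 := by
      apply hΦ.2.2.2
      rw [norm_smul, norm_smul, Real.norm_eq_abs, Real.norm_eq_abs, abs_of_pos (by positivity),
        abs_of_pos (by positivity), ← mul_assoc, mul_comm (16 * π), mul_assoc,
        le_inv_mul_iff₀ hR]
      linarith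
    rw [e1, e2, sub_zero, mul_one]
    have e3 : (1 + ‖(2 * π) • η‖ ^ 2) = R ^ 2 * (R⁻¹ ^ 2 + ‖(2 * π) • R⁻¹ • η‖ ^ 2) := by
      rw [norm_smul, norm_smul, norm_smul, Real.norm_eq_abs R⁻¹, abs_of_pos (by positivity)]
      field_simp
    rw [e3, Real.mul_rpow (by positivity) (by positivity), ← Real.rpow_natCast R 2,
      ← Real.rpow_mul hR.le]
    congr 2
    push_cast; ring
  rw [key]
  ring

/-- averaged quantity -/
def avg {n : ℕ} (R r : ℝ) (u : Eu n → ℝ≥0∞) (x : Eu n) : ℝ≥0∞ := ∫⁻ y, om R r (x - y) * u y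

lemma gradNorm_ge {n : ℕ} (F : Eu n → ℂ) (x : Eu n) (j : Fin n) :
    ‖fderiv ℝ F x (EuclideanSpace.single j 1)‖ ≤ gradNorm F x := by
  unfold gradNorm
  apply Real.le_sqrt_of_sq_le
  exact Finset.single_le_sum (f := fun j => ‖fderiv ℝ F x (EuclideanSpace.single j 1)‖ ^ 2)
    (fun i _ => by positivity) (Finset.mem_univ j)

lemma gradNorm_nonneg {n : ℕ} (F : Eu n → ℂ) (x : Eu n) : 0 ≤ gradNorm F x := Real.sqrt_nonneg _

lemma gradNorm_le {n : ℕ} (F : Eu n → ℂ) (x : Eu n) :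
    gradNorm F x ≤ ∑ j : Fin n, ‖fderiv ℝ F x (EuclideanSpace.single j 1)‖ := by
  unfold gradNorm
  rw [Real.sqrt_le_left (Finset.sum_nonneg fun _ _ => norm_nonneg _)]
  exact Finset.sum_sq_le_sq_sum_of_nonneg (fun _ _ => norm_nonneg _)

lemma fderiv_norm_le {n : ℕ} (L : Eu n →L[ℝ] ℂ) (K : ℝ) (hK : 0 ≤ K)
    (h : ∀ j, ‖L (EuclideanSpace.single j 1)‖ ≤ K) : ‖L‖ ≤ n * K := by
  apply ContinuousLinearMap.opNorm_le_bound _ (by positivity)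
  intro z
  have e : z = ∑ j : Fin n, z j • EuclideanSpace.single j (1 : ℝ) := by
    have := (EuclideanSpace.basisFun (Fin n) ℝ).sum_repr z
    simpa using this.symm
  calc ‖L z‖ = ‖∑ j : Fin n, z j • L (EuclideanSpace.single j 1)‖ := by
        conv_lhs => rw [e]
        simp
    _ ≤ ∑ j : Fin n, ‖z j • L (EuclideanSpace.single j 1)‖ := norm_sum_le _ _
    _ ≤ ∑ j : Fin n, ‖z‖ * K := by
        gcongr with j
        rw [norm_smul]
        gcongr
        · exact PiLp.norm_apply_le z j
        · exact h j
    _ = _ := by simp; ring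

lemma measurable_gradNorm {n : ℕ} (F : SchwartzMap (Eu n) ℂ) : Measurable (gradNorm (⇑F)) := by
  unfold gradNorm
  apply Measurable.sqrt
  apply Finset.measurable_sum
  intro j _
  have : Continuous (fun x => fderiv ℝ (⇑F) x (EuclideanSpace.single j 1)) :=
    (∂_{(EuclideanSpace.single j 1 : Eu n)} F).continuous
  fun_prop

lemma avg_grad_lt_top {n : ℕ} (F : SchwartzMap (Eu n) ℂ) (R r : ℝ) (hR : 0 < R) (hr : 0 ≤ r)
    (x : Eu n) : avg R r (fun y => ‖gradNorm (⇑F) y‖ₑ) x < ∞ := by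
  have hint : Integrable (gradNorm (⇑F)) := by
    have h1 : Integrable (fun x => ∑ j : Fin n, ‖fderiv ℝ (⇑F) x (EuclideanSpace.single j 1)‖) :=
      integrable_finsetSum _ fun j _ => (∂_{(EuclideanSpace.single j 1 : Eu n)} F).integrable.norm
    apply h1.mono' (measurable_gradNorm F).aestronglyMeasurable
    filter_upwards with y
    rw [Real.norm_eq_abs, abs_of_nonneg (gradNorm_nonneg _ _)]
    exact gradNorm_le _ _
  unfold avg
  calc _ ≤ ∫⁻ y, ENNReal.ofReal (R ^ n) * ‖gradNorm (⇑F) y‖ₑ := by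
        apply lintegral_mono; intro y
        dsimp only
        gcongr
        unfold om
        apply ENNReal.ofReal_le_ofReal
        apply mul_le_of_le_one_right (by positivity)
        apply Real.rpow_le_one_of_one_le_of_nonpos _ (by linarith)
        have : 0 ≤ R * ‖x - y‖ := by positivity
        linarith
    _ = ENNReal.ofReal (R ^ n) * ∫⁻ y, ‖gradNorm (⇑F) y‖ₑ :=
        lintegral_const_mul _ (measurable_gradNorm F).enorm
    _ < ∞ := ENNReal.mul_lt_top (by simp) hint.2

lemma avg_shift {n : ℕ} (R r : ℝ) (hR : 0 < R) (hr : 0 ≤ r) (u : Eu n → ℝ≥0∞) (hu : Measurable u)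
    (x v : Eu n) :
    avg R r u v ≤ ENNReal.ofReal ((1 + R * ‖x - v‖) ^ r) * avg R r u x := by
  unfold avg
  rw [← lintegral_const_mul _ (by have := measurable_om (n := n) R r; fun_prop)]
  apply lintegral_mono; intro y
  dsimp only
  rw [← mul_assoc]
  gcongr
  unfold om
  rw [← ENNReal.ofReal_mul (by positivity)]
  apply ENNReal.ofReal_le_ofReal
  rw [mul_left_comm]
  gcongr
  rw [Real.rpow_neg (by positivity), Real.rpow_neg (by positivity), ← div_eq_mul_inv,
    le_div_iff₀ (by positivity), inv_mul_le_iff₀ (by positivity),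
    ← Real.mul_rpow (by positivity) (by positivity)]
  gcongr
  have h1 : ‖x - y‖ ≤ ‖x - v‖ + ‖v - y‖ := by simpa using norm_add_le (x - v) (v - y)
  have h2 : R * ‖x - y‖ ≤ R * ‖x - v‖ + R * ‖v - y‖ := by rw [← mul_add]; gcongr
  have h3 : 0 ≤ R * ‖x - v‖ := by positivity
  have h4 : 0 ≤ R * ‖v - y‖ := by positivity
  nlinarith [mul_nonneg h3 h4]

lemma grad_rep {n : ℕ} (Φ : Eu n → ℝ) (hΦ : IsLPBump Φ) (N : ℕ) :
    ∃ c : ℝ, 0 < c ∧ ∀ R : ℝ, 0 < R → ∀ F : SchwartzMap (Eu n) ℂ,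
      (∀ η, R < 2 * π * ‖η‖ → 𝓕 (⇑F) η = 0) → ∀ j x,
      ‖fderiv ℝ (⇑F) x (EuclideanSpace.single j 1)‖ₑ ≤
        ENNReal.ofReal c * avg R N (fun y => ‖gradNorm (⇑F) y‖ₑ) x := by
  set M : ℝ × Eu n → ℂ := fun z => ((Φ ((2 * π) • z.2) : ℝ) : ℂ)
  have hP := hΦ.1
  have hM : ContDiff ℝ (⊤ : ℕ∞) M := by
    apply Complex.ofRealCLM.contDiff.comp
    fun_prop
  have hB : ∀ ε η, 1 ≤ ‖η‖ → M (ε, η) = 0 := by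
    intro ε η h
    have : 2 ≤ ‖(2 * π) • η‖ := by
      rw [norm_smul, Real.norm_eq_abs, abs_of_pos (by positivity)]
      nlinarith [Real.pi_gt_three]
    simp [M, hΦ.2.2.2 _ this]
  obtain ⟨c, hc, hdec⟩ := decay M hM 1 hB N
  refine ⟨c, hc, fun R hR F hF j x => ?_⟩
  set H := ∂_{(EuclideanSpace.single j 1 : Eu n)} F
  have hHF : ∀ y, H y = fderiv ℝ (⇑F) y (EuclideanSpace.single j 1) := fun y => rfl
  have hHf : ∀ η, R < 2 * π * ‖η‖ → 𝓕 (⇑H) η = 0 := by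
    intro η h
    have := SchwartzMap.fourier_lineDerivOp_eq F (EuclideanSpace.single j 1 : Eu n)
    rw [← SchwartzMap.fourier_coe, this, smul_apply,
      SchwartzMap.smulLeftCLM_apply_apply (by fun_prop), SchwartzMap.fourier_coe, hF η h]
    simp
  have hMi : Integrable (fun η => M (0, η)) :=
    (slice_contDiff _ hM 0).continuous.integrable_of_hasCompactSupport (slice_compact _ _ hB 0)
  have hrep : H x = ∫ y, ((R ^ n : ℝ) : ℂ) * 𝓕⁻ (fun η => M (0, η)) (R • (x - y)) * H y := by
    rw [← mult_conv_scale _ _ hMi H.integrable R hR]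
    have e : (fun η => M (0, R⁻¹ • η) * 𝓕 (⇑H) η) = 𝓕 (⇑H) := by
      ext η
      by_cases h : R < 2 * π * ‖η‖
      · rw [hHf η h, mul_zero]
      · have : ‖(2 * π) • R⁻¹ • η‖ ≤ 1 := by
          rw [norm_smul, norm_smul, Real.norm_eq_abs, Real.norm_eq_abs, abs_of_pos (by positivity),
            abs_of_pos (by positivity), ← mul_assoc, mul_comm (2 * π), mul_assoc,
            inv_mul_le_iff₀ hR]
          linarith
        simp [M, hΦ.2.2.1 _ this]
    rw [e]
    have h3 : 𝓕⁻ (𝓕 H) = H := FourierTransform.fourierInv_fourier_eq H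
    conv_lhs => rw [← h3]
    rw [SchwartzMap.fourierInv_coe, SchwartzMap.fourier_coe]
  rw [← hHF, hrep]
  refine (enorm_integral_le_lintegral_enorm _).trans ?_
  unfold avg
  rw [← lintegral_const_mul _ (by
    have := measurable_om (n := n) R N
    have := measurable_gradNorm F
    fun_prop)]
  apply lintegral_mono; intro y
  dsimp only
  rw [enorm_mul, ← mul_assoc]
  gcongr
  · unfold om
    rw [← ENNReal.ofReal_mul hc.le, ← ofReal_norm, norm_mul, Complex.norm_real, Real.norm_eq_abs,
      abs_of_pos (by positivity)]
    apply ENNReal.ofReal_le_ofReal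
    have := hdec 0 (by simp) (R • (x - y))
    rw [norm_smul, Real.norm_eq_abs, abs_of_pos hR] at this
    calc _ ≤ R ^ n * (c * (1 + R * ‖x - y‖) ^ (-(N : ℝ))) := by gcongr
      _ = _ := by ring
  · rw [← ofReal_norm, ← ofReal_norm]
    apply ENNReal.ofReal_le_ofReal
    rw [Real.norm_eq_abs, abs_of_nonneg (gradNorm_nonneg _ _)]
    exact gradNorm_ge _ _ _

lemma diff_bound {n : ℕ} (Φ : Eu n → ℝ) (hΦ : IsLPBump Φ) (N : ℕ) :
    ∃ c : ℝ, 0 < c ∧ ∀ R : ℝ, 0 < R → ∀ F : SchwartzMap (Eu n) ℂ,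
      (∀ η, R < 2 * π * ‖η‖ → 𝓕 (⇑F) η = 0) → ∀ x y,
      ‖F y - F x‖ ≤ c * ‖x - y‖ * (1 + R * ‖x - y‖) ^ (N : ℝ) *
        (avg R N (fun y => ‖gradNorm (⇑F) y‖ₑ) x).toReal := by
  obtain ⟨c, hc, h⟩ := grad_rep Φ hΦ N
  refine ⟨(n + 1) * c, by positivity, fun R hR F hF x y => ?_⟩
  set A := avg R N (fun y => ‖gradNorm (⇑F) y‖ₑ) with hA
  have hAf : A x < ∞ := avg_grad_lt_top F R N hR (by positivity) x
  set K := c * ((1 + R * ‖x - y‖) ^ (N : ℝ) * (A x).toReal)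
  have hK : 0 ≤ K := by positivity
  have hd : ∀ v ∈ Metric.closedBall x ‖x - y‖, ‖fderiv ℝ (⇑F) v‖ ≤ n * K := by
    intro v hv
    apply fderiv_norm_le _ _ hK
    intro j
    have h1 := h R hR F hF j v
    have h2 := avg_shift R N hR (by positivity) (fun y => ‖gradNorm (⇑F) y‖ₑ)
      (measurable_gradNorm F).enorm x v
    rw [← hA] at h1 h2
    have h3 : ‖fderiv ℝ (⇑F) v (EuclideanSpace.single j 1)‖ₑ ≤ ENNReal.ofReal K := by
      refine h1.trans ?_
      rw [ENNReal.ofReal_mul hc.le, ENNReal.ofReal_mul (by positivity), ENNReal.ofReal_toReal hAf.ne]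
      gcongr
      refine h2.trans ?_
      gcongr
      rw [mem_closedBall_iff_norm, norm_sub_rev] at hv
      exact hv
    rw [← ofReal_norm] at h3
    exact (ENNReal.ofReal_le_ofReal_iff hK).1 h3
  have := (convex_closedBall x ‖x - y‖).norm_image_sub_le_of_norm_fderiv_le (𝕜 := ℝ) (f := ⇑F)
    (fun v _ => F.differentiableAt) hd (x := x) (y := y) (by simp)
    (by rw [mem_closedBall_iff_norm, norm_sub_rev])
  rw [norm_sub_rev y x] at this
  refine this.trans ?_
  calc n * K * ‖x - y‖ ≤ (n + 1) * K * ‖x - y‖ := by gcongr; linarith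
    _ = _ := by simp only [K]; ring

lemma comm_point {n : ℕ} (s : ℝ) (Φ : Eu n → ℝ) (hΦ : IsLPBump Φ) (N : ℕ) :
    ∃ C : ℝ, 0 < C ∧ ∀ R : ℝ, 1 ≤ R → ∀ F G : SchwartzMap (Eu n) ℂ,
      (∀ η, R / 4 ≤ 2 * π * ‖η‖ → 𝓕 (⇑F) η = 0) →
      (∀ η, 2 * π * ‖η‖ ≤ R / 2 → 𝓕 (⇑G) η = 0) →
      (∀ η, 2 * R ≤ 2 * π * ‖η‖ → 𝓕 (⇑G) η = 0) → ∀ x,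
      ‖Js s (fun y => F y * G y) x - F x * Js s (⇑G) x‖ₑ ≤
        ENNReal.ofReal (C * R ^ (s - 1)) *
          (avg R N (fun y => ‖gradNorm (⇑F) y‖ₑ) x * avg R N (fun y => ‖G y‖ₑ) x) := by
  obtain ⟨c, hc, hdiff⟩ := diff_bound Φ hΦ N
  obtain ⟨c', hc', hdec⟩ := decay _ (Msym_contDiff s Φ hΦ) 2 (Msym_zero s Φ hΦ) (2 * N + 1)
  refine ⟨c * c', by positivity, fun R hR F G hF hG1 hG2 x => ?_⟩
  have hR0 : 0 < R := by linarith
  have hFG : Integrable (fun y => F y * G y) :=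
    (SchwartzMap.pairing (ContinuousLinearMap.mul ℂ ℂ) F G).integrable
  have hsupp : ∀ ξ : Eu n, (2 * π * ‖ξ‖ < R / 4 ∨ 4 * R < 2 * π * ‖ξ‖) →
      𝓕 (fun y => F y * G y) ξ = 0 := by
    intro ξ hξ
    apply fourier_mul_zero
    intro η
    by_cases h : R / 4 ≤ 2 * π * ‖η‖
    · exact Or.inl (hF η h)
    right
    push Not at h
    have t1 : ‖ξ - η‖ ≤ ‖ξ‖ + ‖η‖ := norm_sub_le _ _
    have t2 : ‖ξ‖ ≤ ‖ξ - η‖ + ‖η‖ := by simpa using norm_add_le (ξ - η) η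
    have t3 : 2 * π * ‖ξ - η‖ ≤ 2 * π * ‖ξ‖ + 2 * π * ‖η‖ := by rw [← mul_add]; gcongr
    have t4 : 2 * π * ‖ξ‖ ≤ 2 * π * ‖ξ - η‖ + 2 * π * ‖η‖ := by rw [← mul_add]; gcongr
    rcases hξ with hξ | hξ
    · apply hG1; linarith
    · apply hG2; linarith
  rw [Js_rep s Φ hΦ R hR0 _ hFG (fun η h => hsupp η (Or.inl h)) (fun η h => hsupp η (Or.inr h)),
    Js_rep s Φ hΦ R hR0 _ G.integrable (fun η h => hG1 η (by linarith))
      (fun η h => hG2 η (by linarith))]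
  set κ := 𝓕⁻ (fun η => Msym s Φ (R⁻¹, η)) with hκ
  have hdec' := hdec R⁻¹ ⟨by positivity, inv_le_one_of_one_le₀ hR⟩
  rw [← hκ] at hdec'
  have hκc : Continuous κ := by
    have hc := slice_contDiff _ (Msym_contDiff s Φ hΦ) R⁻¹
    have hs := slice_compact _ _ (Msym_zero s Φ hΦ) R⁻¹
    rw [hκ]
    have := (𝓕⁻ (hs.toSchwartzMap hc) : SchwartzMap (Eu n) ℂ).continuous
    rwa [SchwartzMap.fourierInv_coe] at this
  have hκb : ∀ z, ‖κ z‖ ≤ c' := by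
    intro z
    refine (hdec' z).trans ?_
    apply mul_le_of_le_one_right hc'.le
    apply Real.rpow_le_one_of_one_le_of_nonpos
    · linarith [norm_nonneg z]
    · simp only [Left.neg_nonpos_iff]; positivity
  have hint : ∀ h : Eu n → ℂ, Integrable h →
      Integrable (fun y => ((R ^ n : ℝ) : ℂ) * κ (R • (x - y)) * h y) := by
    intro h hh
    apply hh.bdd_mul (c := R ^ n * c') (by fun_prop)
    filter_upwards with y
    rw [norm_mul, Complex.norm_real, Real.norm_eq_abs, abs_of_pos (by positivity)]
    gcongr
    exact hκb _
  have e : ((R ^ s : ℝ) : ℂ) * (∫ y, ((R ^ n : ℝ) : ℂ) * κ (R • (x - y)) * (F y * G y)) -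
      F x * (((R ^ s : ℝ) : ℂ) * ∫ y, ((R ^ n : ℝ) : ℂ) * κ (R • (x - y)) * G y) =
      ((R ^ s : ℝ) : ℂ) * ∫ y, ((R ^ n : ℝ) : ℂ) * κ (R • (x - y)) * ((F y - F x) * G y) := by
    rw [mul_left_comm (F x), ← mul_sub, ← integral_const_mul (F x), ← integral_sub (hint _ hFG)
      ((hint _ G.integrable).const_mul _)]
    congr 2; ext y; ring
  rw [e]
  set A := avg R N (fun y => ‖gradNorm (⇑F) y‖ₑ) x with hA
  have hAf : A < ∞ := avg_grad_lt_top F R N hR0 (by positivity) x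
  rw [enorm_mul]
  calc _ ≤ ‖((R ^ s : ℝ) : ℂ)‖ₑ * ∫⁻ y, ‖((R ^ n : ℝ) : ℂ) * κ (R • (x - y)) * ((F y - F x) * G y)‖ₑ := by
        gcongr
        exact enorm_integral_le_lintegral_enorm _
    _ ≤ ENNReal.ofReal (R ^ s) *
        ∫⁻ y, ENNReal.ofReal (c * c' * R⁻¹ * A.toReal) * (om R N (x - y) * ‖G y‖ₑ) := by
        refine mul_le_mul' ?_ (lintegral_mono fun y => ?_)
        · rw [← ofReal_norm, Complex.norm_real, Real.norm_eq_abs, abs_of_pos (by positivity)]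
        dsimp only
        rw [← mul_assoc, ← mul_assoc, enorm_mul]
        gcongr
        unfold om
        rw [← ENNReal.ofReal_mul (by positivity), ← ofReal_norm]
        apply ENNReal.ofReal_le_ofReal
        rw [norm_mul, norm_mul, Complex.norm_real, Real.norm_eq_abs, abs_of_pos (by positivity)]
        have b1 := hdec' (R • (x - y))
        rw [norm_smul, Real.norm_eq_abs, abs_of_pos hR0] at b1
        have b2 := hdiff R hR0 F (fun η h => hF η (by linarith)) x y
        rw [← hA] at b2
        set t := ‖x - y‖
        have ht : 0 ≤ t := norm_nonneg _
        have b3 : t ≤ R⁻¹ * (1 + R * t) := by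
          rw [mul_add, inv_mul_cancel_left₀ hR0.ne']
          have : 0 < R⁻¹ := by positivity
          linarith
        have hp : 0 < 1 + R * t := by positivity
        calc _ ≤ R ^ n * (c' * (1 + R * t) ^ (-((2 * N + 1 : ℕ) : ℝ))) *
              (c * (R⁻¹ * (1 + R * t)) * (1 + R * t) ^ (N : ℝ) * A.toReal) := by
              gcongr
              refine b2.trans ?_
              gcongr
          _ = c * c' * R⁻¹ * A.toReal * (R ^ n * ((1 + R * t) ^ (-((2 * N + 1 : ℕ) : ℝ)) *
              (1 + R * t) ^ (1 : ℝ) * (1 + R * t) ^ (N : ℝ))) := by rw [Real.rpow_one]; ring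
          _ = _ := by
              rw [← Real.rpow_add hp, ← Real.rpow_add hp]
              congr 3
              push_cast; ring
    _ = _ := by
        rw [lintegral_const_mul _ (by
          have := measurable_om (n := n) R N
          have := G.continuous
          fun_prop)]
        rw [← mul_assoc, ← ENNReal.ofReal_mul (by positivity)]
        have : R ^ s * (c * c' * R⁻¹ * A.toReal) = c * c' * R ^ (s - 1) * A.toReal := by
          rw [Real.rpow_sub hR0, Real.rpow_one]; ring
        rw [this, ENNReal.ofReal_mul (by positivity), ENNReal.ofReal_toReal hAf.ne, mul_assoc]
        rfl

lemma wNorm_avg {n : ℕ} {E : Type*} [NormedAddCommGroup E] (q : ℝ≥0∞) (hq : 1 ≤ q) (a R r : ℝ)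
    (ha : 0 ≤ a) (hR : 1 ≤ R) (u : Eu n → E) (hu : Measurable (fun x => ‖u x‖ₑ)) :
    eLpNorm (fun x => jweight (a / q.toReal) x * avg R r (fun y => ‖u y‖ₑ) x) q volume ≤
      (ENNReal.ofReal (2 ^ (a / q.toReal / 2)) * ∫⁻ z : Eu n, om 1 (r - a / q.toReal) z) *
        wNorm q a u := by
  rw [wNorm_eq q (by positivity)]
  exact weighted_conv q hq _ R r (by positivity) hR _ hu

lemma measurable_avg {n : ℕ} (R r : ℝ) (u : Eu n → ℝ≥0∞) (hu : Measurable u) :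
    Measurable (avg R r u) := by
  unfold avg
  apply Measurable.lintegral_prod_right' (f := fun z : Eu n × Eu n => om R r (z.1 - z.2) * u z.2)
  have := measurable_om (n := n) R r
  fun_prop

lemma weights_real (p p₁ p₂ : ℝ≥0∞) (a a₁ a₂ : ℝ) (hp : 2⁻¹ ≤ p) (hp1 : 1 ≤ p₁) (hp2 : 1 ≤ p₂)
    (ha : 0 ≤ a) (ha1 : 0 ≤ a₁) (ha2 : 0 ≤ a₂)
    (hwexp : ENNReal.ofReal a / p = ENNReal.ofReal a₁ / p₁ + ENNReal.ofReal a₂ / p₂) :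
    a / p.toReal = a₁ / p₁.toReal + a₂ / p₂.toReal := by
  have := congrArg ENNReal.toReal hwexp
  rw [ENNReal.toReal_add (ENNReal.div_ne_top (by simp) (by positivity))
    (ENNReal.div_ne_top (by simp) (by positivity))] at this
  simpa [ENNReal.toReal_div, ENNReal.toReal_ofReal, ha, ha1, ha2] using this

/-- **First-order commutator estimate** (Proposition 3.10). -/
theorem first_order_commutator_estimate (n : ℕ) (hn : 1 ≤ n) (s : ℝ) (hs : 0 < s)
    (p p₁ p₂ : ℝ≥0∞) (a a₁ a₂ : ℝ)
    (hp : 2⁻¹ ≤ p) (hp1 : 1 ≤ p₁) (hp2 : 1 ≤ p₂)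
    (ha : 0 ≤ a) (ha1 : 0 ≤ a₁) (ha2 : 0 ≤ a₂)
    (hexp : 1 / p = 1 / p₁ + 1 / p₂)
    (hwexp : ENNReal.ofReal a / p = ENNReal.ofReal a₁ / p₁ + ENNReal.ofReal a₂ / p₂)
    (Φ : Eu n → ℝ) (hΦ : IsLPBump Φ) :
    ∃ C : ℝ, 0 < C ∧ ∀ k : ℕ, ∀ f g : SchwartzMap (Eu n) ℂ,
      wNorm p a (fun x =>
          Js s (fun y => SProj Φ ((k : ℤ) - 3) ⇑f y * DProj Φ (k : ℤ) ⇑g y) x -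
            SProj Φ ((k : ℤ) - 3) ⇑f x * Js s (DProj Φ (k : ℤ) ⇑g) x) ≤
        ENNReal.ofReal (C * 2 ^ ((k : ℝ) * (s - 1))) *
          (wNorm p₁ a₁ (gradNorm (SProj Φ ((k : ℤ) - 3) ⇑f)) *
            wNorm p₂ a₂ (DProj Φ (k : ℤ) ⇑g)) := by
  have hw := weights_real p p₁ p₂ a a₁ a₂ hp hp1 hp2 ha ha1 ha2 hwexp
  set b₁ := a₁ / p₁.toReal with hb₁
  set b₂ := a₂ / p₂.toReal with hb₂
  have hb1 : 0 ≤ b₁ := by positivity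
  have hb2 : 0 ≤ b₂ := by positivity
  obtain ⟨N, hN⟩ := exists_nat_gt (n + b₁ + b₂)
  obtain ⟨C, hC, hcomm⟩ := comm_point s Φ hΦ N
  set I₁ : ℝ≥0∞ := ENNReal.ofReal (2 ^ (b₁ / 2)) * ∫⁻ z : Eu n, om 1 (N - b₁) z with hI₁
  set I₂ : ℝ≥0∞ := ENNReal.ofReal (2 ^ (b₂ / 2)) * ∫⁻ z : Eu n, om 1 (N - b₂) z with hI₂
  have hI1 : I₁ ≠ ∞ :=
    (ENNReal.mul_lt_top (by simp) (lintegral_om_lt_top _ (by linarith))).ne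
  have hI2 : I₂ ≠ ∞ :=
    (ENNReal.mul_lt_top (by simp) (lintegral_om_lt_top _ (by linarith))).ne
  refine ⟨C * (I₁.toReal + 1) * (I₂.toReal + 1), by positivity, fun k f g => ?_⟩
  obtain ⟨F, hF, hFf⟩ := SProj_schwartz Φ hΦ ((k : ℤ) - 3) f
  obtain ⟨G₁, hG₁, hGf₁⟩ := SProj_schwartz Φ hΦ (k : ℤ) g
  obtain ⟨G₂, hG₂, hGf₂⟩ := SProj_schwartz Φ hΦ ((k : ℤ) - 1) g
  set G := G₁ - G₂ with hGdef
  have hG : ⇑G = DProj Φ (k : ℤ) ⇑g := by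
    ext x
    simp only [hGdef, DProj, ← hG₁, ← hG₂]
    rfl
  have hGf : ∀ η, 𝓕 (⇑G) η = 𝓕 (⇑G₁) η - 𝓕 (⇑G₂) η := by
    intro η
    rw [← SchwartzMap.fourier_coe, hGdef, sub_eq_add_neg, FourierTransform.fourier_add,
      FourierTransform.fourier_neg]
    simp [SchwartzMap.fourier_coe, sub_eq_add_neg]
  set R : ℝ := 2 ^ k with hRdef
  have hR : 1 ≤ R := one_le_pow₀ (by norm_num)
  have hR0 : 0 < R := by linarith
  have z0 : (2 : ℝ) ^ (-(k : ℤ)) = R⁻¹ := by rw [zpow_neg, zpow_natCast]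
  have z1 : (2 : ℝ) ^ (-((k : ℤ) - 1)) = 2 * R⁻¹ := by
    rw [neg_sub, sub_eq_add_neg, zpow_add₀ (by norm_num), z0]; norm_num
  have z3 : (2 : ℝ) ^ (-((k : ℤ) - 3)) = 8 * R⁻¹ := by
    rw [neg_sub, sub_eq_add_neg, zpow_add₀ (by norm_num), z0]; norm_num
  have nrm : ∀ d : ℝ, 0 < d → ∀ η : Eu n, ‖(d * R⁻¹ * (2 * π)) • η‖ = d * (2 * π * ‖η‖) / R := by
    intro d hd η
    rw [norm_smul, Real.norm_eq_abs, abs_of_pos (by positivity)]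
    field_simp
  have c1 : ∀ η, R / 4 ≤ 2 * π * ‖η‖ → 𝓕 (⇑F) η = 0 := by
    intro η h
    rw [hFf, z3, hΦ.2.2.2]
    · simp
    · rw [nrm 8 (by norm_num), le_div_iff₀ hR0]; linarith
  have c2 : ∀ η, 2 * π * ‖η‖ ≤ R / 2 → 𝓕 (⇑G) η = 0 := by
    intro η h
    have h0 : 0 ≤ 2 * π * ‖η‖ := by positivity
    rw [hGf, hGf₁, hGf₂, z0, z1, hΦ.2.2.1, hΦ.2.2.1]
    · simp
    · rw [nrm 2 (by norm_num), div_le_iff₀ hR0]; linarith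
    · rw [← one_mul R⁻¹, nrm 1 (by norm_num), div_le_iff₀ hR0]; linarith
  have c3 : ∀ η, 2 * R ≤ 2 * π * ‖η‖ → 𝓕 (⇑G) η = 0 := by
    intro η h
    rw [hGf, hGf₁, hGf₂, z0, z1, hΦ.2.2.2, hΦ.2.2.2]
    · simp
    · rw [nrm 2 (by norm_num), le_div_iff₀ hR0]; linarith
    · rw [← one_mul R⁻¹, nrm 1 (by norm_num), le_div_iff₀ hR0]; linarith
  have hpt := hcomm R hR F G c1 c2 c3
  rw [← hF, ← hG]
  have hRs : (2 : ℝ) ^ ((k : ℝ) * (s - 1)) = R ^ (s - 1) := by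
    rw [Real.rpow_mul (by norm_num), Real.rpow_natCast]
  rw [hRs]
  have mg : Measurable (fun x => ‖gradNorm (⇑F) x‖ₑ) := (measurable_gradNorm F).enorm
  have mG : Measurable (fun x => ‖G x‖ₑ) := G.continuous.measurable.enorm
  have y1 := wNorm_avg p₁ hp1 a₁ R N ha1 hR (gradNorm (⇑F)) mg
  have y2 := wNorm_avg p₂ hp2 a₂ R N ha2 hR (⇑G) mG
  rw [← hb₁, ← hI₁] at y1
  rw [← hb₂, ← hI₂] at y2
  set A := avg R N (fun y => ‖gradNorm (⇑F) y‖ₑ) with hA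
  set B := avg R N (fun y => ‖G y‖ₑ) with hB
  have mA : Measurable A := measurable_avg _ _ _ mg
  have mB : Measurable B := measurable_avg _ _ _ mG
  have hp0 : p ≠ 0 := by rintro rfl; simp at hp
  rw [wNorm_eq p hp0, hw]
  set K := ENNReal.ofReal (C * R ^ (s - 1)) with hK
  calc _ ≤ K * eLpNorm (fun x => (jweight b₁ x * A x) * (jweight b₂ x * B x)) p volume := by
        apply eLpNorm_le_mul_eLpNorm_of_ae_le_mul''
        · exact (((measurable_jweight b₁).mul mA).mul ((measurable_jweight b₂).mul mB)).aestronglyMeasurable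
        filter_upwards with x
        simp only [enorm_eq_self]
        rw [jweight_add]
        calc _ ≤ jweight b₁ x * jweight b₂ x * (K * (A x * B x)) := by
              gcongr
              exact hpt x
          _ = _ := by ring
    _ ≤ K * (eLpNorm (fun x => jweight b₁ x * A x) p₁ volume *
          eLpNorm (fun x => jweight b₂ x * B x) p₂ volume) := by
        gcongr
        exact holder_enn p p₁ p₂ hp1 hp2 hexp _ _ ((measurable_jweight b₁).mul mA)
          ((measurable_jweight b₂).mul mB)
    _ ≤ K * ((I₁ * wNorm p₁ a₁ (gradNorm (⇑F))) * (I₂ * wNorm p₂ a₂ (⇑G))) := by gcongr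
    _ = (K * I₁ * I₂) * (wNorm p₁ a₁ (gradNorm (⇑F)) * wNorm p₂ a₂ (⇑G)) := by ring
    _ ≤ _ := by
        gcongr
        rw [hK, ← ENNReal.ofReal_toReal hI1, ← ENNReal.ofReal_toReal hI2,
          ← ENNReal.ofReal_mul (by positivity), ← ENNReal.ofReal_mul (by positivity)]
        apply ENNReal.ofReal_le_ofReal
        simp only [ENNReal.toReal_ofReal ENNReal.toReal_nonneg]
        have i1 : 0 ≤ I₁.toReal := ENNReal.toReal_nonneg
        have i2 : 0 ≤ I₂.toReal := ENNReal.toReal_nonneg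
        calc C * R ^ (s - 1) * I₁.toReal * I₂.toReal
            ≤ C * R ^ (s - 1) * (I₁.toReal + 1) * (I₂.toReal + 1) := by gcongr <;> linarith
          _ = _ := by ring
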